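/- arXiv:1510.04050 — 5 statements merged into one kernel-verified Lean document; each statement's English description precedes it below -/
import Mathlib

section
/- If an ℵ₀-tangle τ of G contains two oriented separations (A,B) and (A',B'), then τ also contains (A ∪ A', B ∩ B'). -/
open Set

variable {V : Type*}

/-- `{A,B}` is a separation of `G`: `A ∪ B = V` and no edge between `A∖B` and `B∖A`. -/
def IsSep (G : SimpleGraph V) (A B : Set V) : Prop :=
  A ∪ B = Set.univ ∧ ∀ a ∈ A \ B, ∀ b ∈ B \ A, ¬ G.Adj a b

/-- A separation of finite order. -/
def IsFinSep (G : SimpleGraph V) (A B : Set V) : Prop :=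
  IsSep G A B ∧ (A ∩ B).Finite

/-- The set `S⃗` of oriented finite-order separations of `G`, as ordered pairs. -/
def Svec (G : SimpleGraph V) : Set (Set V × Set V) :=
  {p | IsFinSep G p.1 p.2}

/-- `(A,B) ≤ (C,D)` iff `A ⊆ C` and `D ⊆ B`. -/
def sepLE (p q : Set V × Set V) : Prop :=
  p.1 ⊆ q.1 ∧ q.2 ⊆ p.2

/-- An orientation of the set `S` of finite-order separations: a subset of `S⃗` containing
exactly one of `(A,B)`, `(B,A)` for every finite-order separation `{A,B}`. -/
def IsOrientation (G : SimpleGraph V) (O : Set (Set V × Set V)) : Prop :=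
  O ⊆ Svec G ∧ ∀ A B : Set V, IsFinSep G A B → ((A, B) ∈ O ↔ (B, A) ∉ O)

/-- Consistency: no two distinct members `(B,A)`, `(C,D)` with `(A,B) < (C,D)`. -/
def Consistent (O : Set (Set V × Set V)) : Prop :=
  ∀ A B C D : Set V, (B, A) ∈ O → (C, D) ∈ O → (B, A) ≠ (C, D) →
    ¬ (sepLE (A, B) (C, D) ∧ (A, B) ≠ (C, D))

/-- A star in `S⃗`: every two distinct elements point towards each other. -/
def IsStar (G : SimpleGraph V) (σ : Set (Set V × Set V)) : Prop :=
  σ ⊆ Svec G ∧ ∀ p ∈ σ, ∀ q ∈ σ, p ≠ q → sepLE p (q.2, q.1)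

/-- Membership in `T_n`: a star of at most `n` elements whose target sides have finite
intersection. -/
def InTn (G : SimpleGraph V) (n : ℕ) (σ : Set (Set V × Set V)) : Prop :=
  IsStar G σ ∧ σ.Finite ∧ σ.ncard ≤ n ∧ (⋂ p ∈ σ, p.2).Finite

/-- Membership in `T`: an arbitrary star whose target sides have finite intersection. -/
def InT (G : SimpleGraph V) (σ : Set (Set V × Set V)) : Prop :=
  IsStar G σ ∧ (⋂ p ∈ σ, p.2).Finite

/-- An `ℵ₀`-tangle of `G`: a consistent orientation of `S` with no subset in `T₃`. -/
def IsTangle (G : SimpleGraph V) (τ : Set (Set V × Set V)) : Prop :=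
  IsOrientation G τ ∧ Consistent τ ∧ ∀ σ ⊆ τ, ¬ InTn G 3 σ

/-- A `T`-tangle of `S`: a consistent orientation of `S` with no subset in `T`. -/
def IsTTangle (G : SimpleGraph V) (τ : Set (Set V × Set V)) : Prop :=
  IsOrientation G τ ∧ Consistent τ ∧ ∀ σ ⊆ τ, ¬ InT G σ

/-- The set `𝒞_X` of (vertex sets of) connected components of `G − X`. -/
def Comps (G : SimpleGraph V) (X : Set V) : Set (Set V) :=
  {C | ∃ c : (G.induce Xᶜ).ConnectedComponent, C = Subtype.val '' c.supp}

/-- A collection of subsets of `α` is an ultrafilter on `α`. -/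
def IsUltra {α : Type*} (F : Set (Set α)) : Prop :=
  ∅ ∉ F ∧ (∀ s ∈ F, ∀ t ∈ F, s ∩ t ∈ F) ∧ (∀ s ∈ F, ∀ t : Set α, s ⊆ t → t ∈ F) ∧
    ∀ s : Set α, s ∈ F ∨ sᶜ ∈ F

/-- A principal ultrafilter, generated by a single point. -/
def IsPrincipalUF {α : Type*} (F : Set (Set α)) : Prop :=
  ∃ a : α, F = {s | a ∈ s}

/-- `U(τ,X)`: the collection of all sets `𝒮` of components of `G − X` with
`(⋃(𝒞_X∖𝒮) ∪ X, ⋃𝒮 ∪ X) ∈ τ`. -/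
def tangleUF (G : SimpleGraph V) (τ : Set (Set V × Set V)) (X : Set V) :
    Set (Set ↥(Comps G X)) :=
  {𝒮 | ((⋃ C ∈ 𝒮ᶜ, (C : Set V)) ∪ X, (⋃ C ∈ 𝒮, (C : Set V)) ∪ X) ∈ τ}

/-- `f_{X',X}`: the pushforward of an ultrafilter on `𝒞_{X'}` along the map sending each
component of `G − X'` to the component of `G − X` containing it. -/
def pushUF (G : SimpleGraph V) (X X' : Set V) (F : Set (Set ↥(Comps G X'))) :
    Set (Set ↥(Comps G X)) :=
  {𝒮 | {C' : ↥(Comps G X') | ∃ C ∈ 𝒮, (C' : Set V) ⊆ (C : Set V)} ∈ F}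

/-- A direction in `G`: a choice of a component of `G − X` for every finite `X ⊆ V`,
compatible under inclusion. -/
def IsDirection (G : SimpleGraph V) (f : Set V → Set V) : Prop :=
  (∀ X : Set V, X.Finite → f X ∈ Comps G X) ∧
    ∀ X X' : Set V, X.Finite → X'.Finite → X ⊆ X' → f X' ⊆ f X

theorem IsFinSep.symm {G : SimpleGraph V} {A B : Set V} (h : IsFinSep G A B) :
    IsFinSep G B A :=
  ⟨⟨by rw [union_comm]; exact h.1.1, fun a ha b hb hab => h.1.2 b hb a ha hab.symm⟩,
    by rw [inter_comm]; exact h.2⟩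

/-- The supremum of two separations of finite order is a separation of finite order. -/
theorem IsFinSep.sup {G : SimpleGraph V} {A B A' B' : Set V} (h : IsFinSep G A B)
    (h' : IsFinSep G A' B') : IsFinSep G (A ∪ A') (B ∩ B') := by
  obtain ⟨⟨hU, hE⟩, hF⟩ := h
  obtain ⟨⟨hU', hE'⟩, hF'⟩ := h'
  rw [eq_univ_iff_forall] at hU hU'
  refine ⟨⟨eq_univ_of_forall fun x => ?_, fun a ha b hb hab => ?_⟩,
    (hF.union hF').subset fun x hx => ?_⟩
  · have := hU x
    have := hU' x
    simp only [mem_union, mem_inter_iff] at *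
    tauto
  · have := hU a
    have := hU' a
    have := hE a
    have := hE' a
    simp only [mem_union, mem_inter_iff, mem_sdiff] at *
    grind
  · simp only [mem_union, mem_inter_iff] at *
    tauto

/-- A tangle contains no separation whose target side is finite. -/
theorem IsTangle.infinite_snd {G : SimpleGraph V} {τ : Set (Set V × Set V)}
    (hτ : IsTangle G τ) {A B : Set V} (h : (A, B) ∈ τ) : B.Infinite := by
  intro hB
  refine hτ.2.2 {(A, B)} (by simpa using h) ⟨⟨?_, ?_⟩, finite_singleton _, by simp, by simpa⟩
  · simpa using hτ.1.1 h
  · rintro p rfl q rfl hpq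
    exact absurd rfl hpq

/-- A tangle is closed under passing to smaller separations of finite order. -/
theorem IsTangle.mem_of_le {G : SimpleGraph V} {τ : Set (Set V × Set V)}
    (hτ : IsTangle G τ) {A B C D : Set V} (hCD : (C, D) ∈ τ) (hAB : IsFinSep G A B)
    (hle : sepLE (A, B) (C, D)) : (A, B) ∈ τ := by
  by_contra hn
  have hBA : (B, A) ∈ τ := (hτ.1.2 B A hAB.symm).2 hn
  refine hτ.2.1 A B C D hBA hCD (fun heq => ?_) ⟨hle, fun heq => hn (heq ▸ hCD)⟩
  obtain ⟨rfl, rfl⟩ := Prod.mk.inj heq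
  exact hτ.infinite_snd hCD (hAB.2.subset fun x hx => ⟨hx, hle.1 hx⟩)

/-- Lemma 1.2: if an `ℵ₀`-tangle contains `(A,B)` and `(A',B')`, it also
contains `(A ∪ A', B ∩ B')`. -/
theorem stmt1 [Infinite V] (G : SimpleGraph V) (τ : Set (Set V × Set V))
    (hτ : IsTangle G τ) (A B A' B' : Set V)
    (h : (A, B) ∈ τ) (h' : (A', B') ∈ τ) :
    (A ∪ A', B ∩ B') ∈ τ := by
  have hS : IsFinSep G A B := hτ.1.1 h
  have hS' : IsFinSep G A' B' := hτ.1.1 h'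
  have hsup := hS.sup hS'
  have hcorner : IsFinSep G (B ∩ A') (A ∪ B') := (hS.sup hS'.symm).symm
  have hcornerτ : (B ∩ A', A ∪ B') ∈ τ :=
    hτ.mem_of_le h' hcorner ⟨inter_subset_right, subset_union_right⟩
  by_contra hn
  have hinv : (B ∩ B', A ∪ A') ∈ τ := (hτ.1.2 _ _ hsup.symm).2 hn
  have hsub : ({(A, B), (B ∩ A', A ∪ B'), (B ∩ B', A ∪ A')} : Set (Set V × Set V)) ⊆ τ := by
    rintro p (rfl | rfl | rfl) <;> assumption
  refine hτ.2.2 _ hsub ⟨⟨hsub.trans hτ.1.1, ?_⟩, toFinite _, ?_, ?_⟩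
  · rintro p (rfl | rfl | rfl) q (rfl | rfl | rfl) hpq <;>
      first
      | exact absurd rfl hpq
      | constructor <;> intro x <;> simp only [mem_union, mem_inter_iff] <;> tauto
  · exact (ncard_insert_le _ _).trans (Nat.succ_le_succ ((ncard_insert_le _ _).trans (by simp)))
  · refine (hS.2.union hS'.2).subset fun x hx => ?_
    simp only [mem_insert_iff, mem_singleton_iff, iInter_iInter_eq_or_left,
      iInter_iInter_eq_left, mem_union, mem_inter_iff] at *
    tauto
end

section
/- A consistent orientation O of S is a T₃-tangle (i.e. has no star subset in T₃) if and only if O contains no triple (A₁,B₁), (A₂,B₂), (A₃,B₃) of (not necessarily distinct) oriented separations such that A₁ ∪ A₂ ∪ A₃ = V and every edge of G has both endvertices in some A_i (i.e. G[A₁] ∪ G[A₂] ∪ G[A₃] = G). -/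
open Set

variable {V : Type*}

theorem IsFinSep.mem_or_mem {G : SimpleGraph V} {A B : Set V} (h : IsFinSep G A B) (x : V) :
    x ∈ A ∨ x ∈ B := by
  have : x ∈ A ∪ B := by rw [h.1.1]; trivial
  exact this

theorem IsFinSep.mem_left_of_adj {G : SimpleGraph V} {A B : Set V} (h : IsFinSep G A B)
    {u v : V} (huv : G.Adj u v) (hu : u ∉ B) : u ∈ A ∧ v ∈ A := by
  have hA := (h.mem_or_mem u).resolve_right hu
  refine ⟨hA, by_contra fun hv => ?_⟩
  exact h.1.2 u ⟨hA, hu⟩ v ⟨(h.mem_or_mem v).resolve_left hv, hv⟩ huv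

/-- The infimum of two separations of finite order is a separation of finite order. -/
theorem IsFinSep.inter_union {G : SimpleGraph V} {A B C D : Set V}
    (h : IsFinSep G A B) (k : IsFinSep G C D) : IsFinSep G (A ∩ C) (B ∪ D) := by
  refine ⟨⟨?_, ?_⟩, (h.2.union k.2).subset ?_⟩
  · ext x
    have := h.mem_or_mem x
    have := k.mem_or_mem x
    simp only [Set.mem_union, Set.mem_inter_iff, Set.mem_univ, iff_true]
    tauto
  · rintro a ⟨-, ha⟩ b ⟨-, hb⟩ hab
    simp only [Set.mem_union, not_or] at ha
    exact hb ⟨(h.mem_left_of_adj hab ha.1).2, (k.mem_left_of_adj hab ha.2).2⟩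
  · rintro x ⟨⟨hA, hC⟩, hB | hD⟩
    · exact Or.inl ⟨hA, hB⟩
    · exact Or.inr ⟨hC, hD⟩

/-- A vertex set can be added to the small side of a separation, preserving finiteness of the
order if that vertex set is finite. -/
theorem IsFinSep.union_left {G : SimpleGraph V} {A B X : Set V} (h : IsFinSep G A B)
    (hX : X.Finite) : IsFinSep G (A ∪ X) B := by
  refine ⟨⟨?_, ?_⟩, (h.2.union hX).subset ?_⟩
  · rw [Set.union_right_comm, h.1.1, Set.univ_union]
  · rintro a ⟨-, ha⟩ b ⟨-, hb⟩ hab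
    exact hb (Or.inl (h.mem_left_of_adj hab ha).2)
  · rintro x ⟨hA | hx, hB⟩
    · exact Or.inl ⟨hA, hB⟩
    · exact Or.inr hx

/-- A consistent orientation without singleton stars in `T₃` is closed under passing to smaller
separations. -/
theorem Consistent.mem_of_sepLE {G : SimpleGraph V} {O : Set (Set V × Set V)}
    (hO : IsOrientation G O) (hc : Consistent O) (hT : ∀ σ ⊆ O, ¬ InTn G 3 σ)
    {A B C D : Set V} (hAB : IsFinSep G A B) (hCD : (C, D) ∈ O)
    (hle : sepLE (A, B) (C, D)) : (A, B) ∈ O := by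
  by_contra hn
  have hBA : (B, A) ∈ O := (hO.2 B A hAB.symm).2 hn
  refine hc A B C D hBA hCD (fun heq => ?_) ⟨hle, fun heq => hn (heq ▸ hCD)⟩
  obtain ⟨rfl, rfl⟩ := Prod.mk.inj heq
  refine hT {(B, A)} (Set.singleton_subset_iff.2 hBA) ⟨⟨?_, ?_⟩, Set.finite_singleton _, ?_, ?_⟩
  · exact Set.singleton_subset_iff.2 (hO.1 hBA)
  · rintro p rfl q rfl hne
    exact absurd rfl hne
  · simp
  · simpa using hAB.2.subset fun x hx => ⟨hx, hle.1 hx⟩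

/-- Three separations covering the vertex set can be uncrossed to a star in `T₃`. -/
theorem exists_inTn_of_cover {G : SimpleGraph V} {O : Set (Set V × Set V)}
    (hO : IsOrientation G O) (hc : Consistent O) {A₁ B₁ A₂ B₂ A₃ B₃ : Set V}
    (h₁ : (A₁, B₁) ∈ O) (h₂ : (A₂, B₂) ∈ O) (h₃ : (A₃, B₃) ∈ O)
    (hA : A₁ ∪ A₂ ∪ A₃ = Set.univ) : ∃ σ ⊆ O, InTn G 3 σ := by
  by_contra! hT
  have s₁ : IsFinSep G A₁ B₁ := hO.1 h₁
  have s₂ : IsFinSep G A₂ B₂ := hO.1 h₂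
  have s₃ : IsFinSep G A₃ B₃ := hO.1 h₃
  have k₂ : (A₂ ∩ B₁, B₂ ∪ A₁) ∈ O :=
    hc.mem_of_sepLE hO hT (s₂.inter_union s₁.symm) h₂
      ⟨Set.inter_subset_left, Set.subset_union_left⟩
  have k₃ : (A₃ ∩ B₁ ∩ B₂, B₃ ∪ A₁ ∪ A₂) ∈ O :=
    hc.mem_of_sepLE hO hT ((s₃.inter_union s₁.symm).inter_union s₂.symm) h₃
      ⟨fun x hx => hx.1.1, fun x hx => Or.inl (Or.inl hx)⟩
  have hsub : ({(A₁, B₁), (A₂ ∩ B₁, B₂ ∪ A₁), (A₃ ∩ B₁ ∩ B₂, B₃ ∪ A₁ ∪ A₂)} :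
      Set (Set V × Set V)) ⊆ O := by
    rintro p (rfl | rfl | rfl) <;> assumption
  refine hT _ hsub ⟨⟨hsub.trans hO.1, ?_⟩, Set.toFinite _, ?_, ?_⟩
  · rintro p (rfl | rfl | rfl) q (rfl | rfl | rfl) hne <;>
      first
      | exact absurd rfl hne
      | constructor <;> intro x <;>
          simp only [Set.mem_union, Set.mem_inter_iff] <;> tauto
  · refine (Set.ncard_insert_le _ _).trans (Nat.succ_le_succ ?_)
    refine (Set.ncard_insert_le _ _).trans (Nat.succ_le_succ ?_)
    simp
  · refine ((s₁.2.union s₂.2).union s₃.2).subset fun x hx => ?_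
    have hx' : x ∈ A₁ ∪ A₂ ∪ A₃ := by rw [hA]; trivial
    simp only [Set.mem_insert_iff, Set.mem_singleton_iff, Set.iInter_iInter_eq_or_left,
      Set.iInter_iInter_eq_left, Set.mem_inter_iff, Set.mem_union] at hx hx' ⊢
    tauto

/-- In a nonempty set of at most three pairs, three members suffice to realise the intersection
of the second components. -/
theorem exists_inter_subset_iInter_of_ncard_le_three {σ : Set (Set V × Set V)}
    (hfin : σ.Finite) (hcard : σ.ncard ≤ 3) (hne : σ.Nonempty) :
    ∃ p ∈ σ, ∃ q ∈ σ, ∃ r ∈ σ, p.2 ∩ q.2 ∩ r.2 ⊆ ⋂ s ∈ σ, s.2 := by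
  have hpos : 0 < σ.ncard := (Set.ncard_pos hfin).2 hne
  suffices ∃ p q r, σ = {p, q, r} by
    obtain ⟨p, q, r, rfl⟩ := this
    refine ⟨p, by simp, q, by simp, r, by simp, fun x hx => ?_⟩
    simpa [and_assoc] using hx
  obtain h | h | h : σ.ncard = 1 ∨ σ.ncard = 2 ∨ σ.ncard = 3 := by omega
  · obtain ⟨p, rfl⟩ := Set.ncard_eq_one.1 h
    exact ⟨p, p, p, by simp⟩
  · obtain ⟨p, q, -, rfl⟩ := Set.ncard_eq_two.1 h
    exact ⟨p, q, q, by simp⟩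
  · obtain ⟨p, q, r, -, -, -, rfl⟩ := Set.ncard_eq_three.1 h
    exact ⟨p, q, r, rfl⟩

/-- If no three members of `O` cover `G`, adding a finite set to the small side of a member
yields a member. -/
theorem union_left_mem_of_no_cover {G : SimpleGraph V} {O : Set (Set V × Set V)}
    (hO : IsOrientation G O)
    (hN : ¬ ∃ A₁ B₁ A₂ B₂ A₃ B₃ : Set V,
        (A₁, B₁) ∈ O ∧ (A₂, B₂) ∈ O ∧ (A₃, B₃) ∈ O ∧
        A₁ ∪ A₂ ∪ A₃ = Set.univ ∧
        ∀ u v : V, G.Adj u v →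
          (u ∈ A₁ ∧ v ∈ A₁) ∨ (u ∈ A₂ ∧ v ∈ A₂) ∨ (u ∈ A₃ ∧ v ∈ A₃))
    {A B X : Set V} (h : (A, B) ∈ O) (hX : X.Finite) : (A ∪ X, B) ∈ O := by
  have s : IsFinSep G A B := hO.1 h
  by_contra hn
  have hB : (B, A ∪ X) ∈ O := (hO.2 _ _ (s.union_left hX).symm).2 hn
  refine hN ⟨A, B, B, A ∪ X, B, A ∪ X, h, hB, hB, ?_, fun u v huv => ?_⟩
  · rw [s.1.1, Set.univ_union]
  · by_cases hu : u ∈ B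
    · by_cases hv : v ∈ B
      · exact Or.inr (Or.inl ⟨hu, hv⟩)
      · exact Or.inl (s.mem_left_of_adj huv.symm hv).symm
    · exact Or.inl (s.mem_left_of_adj huv hu)


/-- Lemma 1.3: a consistent orientation `O` of `S` is a `T₃`-tangle iff it
contains no triple `(A₁,B₁),(A₂,B₂),(A₃,B₃)` with `G[A₁] ∪ G[A₂] ∪ G[A₃] = G`. -/
theorem stmt2 [Infinite V] (G : SimpleGraph V) (O : Set (Set V × Set V))
    (hO : IsOrientation G O) (hc : Consistent O) :
    (∀ σ ⊆ O, ¬ InTn G 3 σ) ↔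
      ¬ ∃ A₁ B₁ A₂ B₂ A₃ B₃ : Set V,
        (A₁, B₁) ∈ O ∧ (A₂, B₂) ∈ O ∧ (A₃, B₃) ∈ O ∧
        A₁ ∪ A₂ ∪ A₃ = Set.univ ∧
        ∀ u v : V, G.Adj u v →
          (u ∈ A₁ ∧ v ∈ A₁) ∨ (u ∈ A₂ ∧ v ∈ A₂) ∨ (u ∈ A₃ ∧ v ∈ A₃) := by
  constructor
  · rintro hT ⟨A₁, B₁, A₂, B₂, A₃, B₃, h₁, h₂, h₃, hA, -⟩
    obtain ⟨σ, hσ, hσT⟩ := exists_inTn_of_cover hO hc h₁ h₂ h₃ hA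
    exact hT σ hσ hσT
  · rintro hN σ hσ ⟨-, hfin, hcard, hX⟩
    have hne : σ.Nonempty := by
      rw [Set.nonempty_iff_ne_empty]
      rintro rfl
      simp only [Set.mem_empty_iff_false, Set.iInter_of_empty, Set.iInter_univ] at hX
      exact Set.infinite_univ hX
    obtain ⟨⟨A₁, B₁⟩, h₁, ⟨A₂, B₂⟩, h₂, ⟨A₃, B₃⟩, h₃, hsub⟩ :=
      exists_inter_subset_iInter_of_ncard_le_three hfin hcard hne
    have hX' : (B₁ ∩ B₂ ∩ B₃).Finite := hX.subset hsub
    have s₁ : IsFinSep G A₁ B₁ := hO.1 (hσ h₁)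
    have s₂ : IsFinSep G A₂ B₂ := hO.1 (hσ h₂)
    have s₃ : IsFinSep G A₃ B₃ := hO.1 (hσ h₃)
    refine hN ⟨_, _, _, _, _, _, union_left_mem_of_no_cover hO hN (hσ h₁) hX',
      hσ h₂, hσ h₃, ?_, fun u v huv => ?_⟩
    · ext x
      have := s₁.mem_or_mem x
      have := s₂.mem_or_mem x
      have := s₃.mem_or_mem x
      simp only [Set.mem_union, Set.mem_inter_iff, Set.mem_univ, iff_true]
      tauto
    · have := s₁.mem_left_of_adj huv
      have := s₂.mem_left_of_adj huv
      have := s₃.mem_left_of_adj huv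
      have := s₁.mem_left_of_adj huv.symm
      have := s₂.mem_left_of_adj huv.symm
      have := s₃.mem_left_of_adj huv.symm
      simp only [Set.mem_union, Set.mem_inter_iff]
      tauto
end

section
/- Let τ be an ℵ₀-tangle of G and (A,B) ∈ τ. If (A',B') is an oriented separation of G such that the symmetric differences A △ A' and B △ B' are both finite, then (A',B') ∈ τ. -/
open Set

variable {V : Type*}

/-- Enlarging the two sides of a finite-order separation by finite sets gives a finite-order
separation. -/
theorem IsFinSep.union_finite {G : SimpleGraph V} {A B X Y : Set V} (h : IsFinSep G A B)
    (hX : X.Finite) (hY : Y.Finite) : IsFinSep G (A ∪ X) (B ∪ Y) := by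
  obtain ⟨⟨hcover, hadj⟩, hfin⟩ := h
  have hmem : ∀ v, v ∈ A ∨ v ∈ B := fun v => by
    simpa using hcover.symm.subset (mem_univ v)
  refine ⟨⟨?_, fun a ha b hb => hadj a ?_ b ?_⟩, ?_⟩
  · ext v
    have := hmem v
    simp only [mem_union, mem_univ, iff_true]
    tauto
  · have := hmem a
    simp only [mem_sdiff, mem_union] at ha ⊢
    tauto
  · have := hmem b
    simp only [mem_sdiff, mem_union] at hb ⊢
    tauto
  · refine ((hfin.union hX).union hY).subset fun v hv => ?_
    simp only [mem_inter_iff, mem_union] at hv ⊢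
    tauto

theorem IsFinSep.ne [Infinite V] {G : SimpleGraph V} {A B : Set V} (h : IsFinSep G A B) :
    A ≠ B := by
  rintro rfl
  have hA : A = univ := by simpa using h.1.1
  have hfin := h.2
  rw [hA, inter_self] at hfin
  exact infinite_univ hfin

/-- A tangle is closed under enlarging the target side by a finite set. -/
theorem IsTangle.union_right_mem [Infinite V] {G : SimpleGraph V} {τ : Set (Set V × Set V)}
    (hτ : IsTangle G τ) {A B X : Set V} (h : (A, B) ∈ τ) (hX : X.Finite) :
    (A, B ∪ X) ∈ τ := by
  obtain ⟨⟨hsub, horient⟩, hcons, -⟩ := hτ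
  have hAB : IsFinSep G A B := hsub h
  have hAX : IsFinSep G A (B ∪ X) := by simpa using hAB.union_finite finite_empty hX
  rw [horient _ _ hAX]
  intro hflip
  refine hcons A (B ∪ X) A B hflip h (fun heq => hAB.ne (Prod.mk.inj heq).2)
    ⟨⟨subset_rfl, subset_union_left⟩, fun heq => ?_⟩
  rw [(Prod.mk.inj heq).2] at hflip
  exact (horient _ _ hAB).1 h hflip

/-- A tangle is closed under enlarging both sides by the same finite set. -/
theorem IsTangle.union_mem [Infinite V] {G : SimpleGraph V} {τ : Set (Set V × Set V)}
    (hτ : IsTangle G τ) {A B X : Set V} (h : (A, B) ∈ τ) (hX : X.Finite) :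
    (A ∪ X, B ∪ X) ∈ τ := by
  have hright := hτ.union_right_mem h hX
  obtain ⟨⟨hsub, horient⟩, -, hstar⟩ := hτ
  have hfin : IsFinSep G (A ∪ X) (B ∪ X) := (hsub h).union_finite hX hX
  rw [horient _ _ hfin]
  intro hflip
  have hpair : {(A, B ∪ X), (B ∪ X, A ∪ X)} ⊆ τ := pair_subset hright hflip
  refine hstar _ hpair ⟨⟨hpair.trans hsub, ?_⟩, toFinite _,
    (ncard_insert_le _ _).trans (by simp), ?_⟩
  · rintro p (rfl | rfl) q (rfl | rfl) hne
    · exact absurd rfl hne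
    · exact ⟨subset_union_left, subset_rfl⟩
    · exact ⟨subset_rfl, subset_union_left⟩
    · exact absurd rfl hne
  · simpa [inter_comm] using hfin.2

theorem union_eq_union_of_symmDiff_subset {α : Type*} {s t X : Set α} (h : symmDiff s t ⊆ X) :
    s ∪ X = t ∪ X := by
  ext v
  have := @h v
  simp only [mem_symmDiff, mem_union] at this ⊢
  tauto

/-- Lemma 1.10: tangles are invariant under finite modifications of the two
sides of a separation. -/
theorem stmt5 [Infinite V] (G : SimpleGraph V) (τ : Set (Set V × Set V))
    (hτ : IsTangle G τ) (A B A' B' : Set V) (h : (A, B) ∈ τ)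
    (hsep : IsSep G A' B')
    (hA : (symmDiff A A').Finite) (hB : (symmDiff B B').Finite) :
    (A', B') ∈ τ := by
  set X := symmDiff A A' ∪ symmDiff B B'
  have hX : X.Finite := hA.union hB
  have hAX : A ∪ X = A' ∪ X := union_eq_union_of_symmDiff_subset subset_union_left
  have hBX : B ∪ X = B' ∪ X := union_eq_union_of_symmDiff_subset subset_union_right
  have hmem : (A ∪ X, B ∪ X) ∈ τ := hτ.union_mem h hX
  have hfinX : IsFinSep G (A ∪ X) (B ∪ X) := hτ.1.1 hmem
  have hfin : IsFinSep G A' B' :=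
    ⟨hsep, hfinX.2.subset <| by
      rw [hAX, hBX]
      exact inter_subset_inter subset_union_left subset_union_left⟩
  rw [hτ.1.2 _ _ hfin]
  intro hflip
  have hmem_flip := hτ.union_mem hflip hX
  rw [← hAX, ← hBX] at hmem_flip
  exact (hτ.1.2 _ _ hfinX).1 hmem hmem_flip
end

section
/- For every ℵ₀-tangle τ of G and every finite set X ⊆ V, the collection U(τ,X) of all sets 𝒞 of connected components of G − X such that (⋃(𝒞_X∖𝒞) ∪ X, ⋃𝒞 ∪ X) ∈ τ is an ultrafilter on the set 𝒞_X of connected components of G − X. -/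
open Set

variable {V : Type*}

/-- The vertices of `X` together with those of the components of `G − X` in `s`. -/
def compSide (G : SimpleGraph V) (X : Set V) (s : Set ↥(Comps G X)) : Set V :=
  (⋃ C ∈ s, (C : Set V)) ∪ X

/-- The oriented separation pointing to the components of `G − X` in `s`. -/
def compSep (G : SimpleGraph V) (X : Set V) (s : Set ↥(Comps G X)) : Set V × Set V :=
  (compSide G X sᶜ, compSide G X s)

section ComponentSeparations

variable {G : SimpleGraph V} {X : Set V} {s t : Set ↥(Comps G X)}

lemma mem_tangleUF_iff {τ : Set (Set V × Set V)} :
    s ∈ tangleUF G τ X ↔ compSep G X s ∈ τ := Iff.rfl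

/-- The component of `G − X` containing a vertex outside `X`. -/
def compOf (G : SimpleGraph V) (X : Set V) (v : V) (hv : v ∉ X) : ↥(Comps G X) :=
  ⟨Subtype.val '' ((G.induce Xᶜ).connectedComponentMk ⟨v, hv⟩).supp, _, rfl⟩

lemma mem_comp_iff (C : ↥(Comps G X)) {v : V} (hv : v ∉ X) :
    v ∈ (C : Set V) ↔ C = compOf G X v hv := by
  obtain ⟨_, c, rfl⟩ := C
  constructor
  · rintro ⟨w, hw, rfl⟩
    have hc : (G.induce Xᶜ).connectedComponentMk w = c := hw
    subst hc
    rfl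
  · intro h
    have hval : Subtype.val '' c.supp = _ := congrArg Subtype.val h
    change v ∈ Subtype.val '' c.supp
    rw [hval]
    exact ⟨⟨v, hv⟩, rfl, rfl⟩

lemma mem_compSide_iff {v : V} (hv : v ∉ X) :
    v ∈ compSide G X s ↔ compOf G X v hv ∈ s := by
  simp only [compSide, mem_union, mem_iUnion, exists_prop, hv, or_false]
  constructor
  · rintro ⟨C, hC, hvC⟩
    rwa [← (mem_comp_iff C hv).1 hvC]
  · exact fun h => ⟨_, h, (mem_comp_iff _ hv).2 rfl⟩

lemma subset_compSide : X ⊆ compSide G X s := subset_union_right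

lemma compSide_mono (h : s ⊆ t) : compSide G X s ⊆ compSide G X t :=
  union_subset_union_left _ (biUnion_subset_biUnion_left h)

lemma compSide_empty : compSide G X ∅ = X := by simp [compSide]

lemma compSide_inter : compSide G X s ∩ compSide G X t = compSide G X (s ∩ t) := by
  ext v
  by_cases hv : v ∈ X
  · simp [subset_compSide hv]
  · simp [mem_compSide_iff hv]

lemma compOf_eq_of_adj {a b : V} (ha : a ∉ X) (hb : b ∉ X) (h : G.Adj a b) :
    compOf G X a ha = compOf G X b hb := by
  have hab : (G.induce Xᶜ).Adj ⟨a, ha⟩ ⟨b, hb⟩ := h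
  simp only [compOf, SimpleGraph.ConnectedComponent.sound hab.reachable]

lemma isFinSep_compSide (hX : X.Finite) (s : Set ↥(Comps G X)) :
    IsFinSep G (compSide G X sᶜ) (compSide G X s) := by
  refine ⟨⟨?_, ?_⟩, ?_⟩
  · refine eq_univ_of_forall fun v => ?_
    by_cases hv : v ∈ X
    · exact Or.inl (subset_compSide hv)
    · simp only [mem_union, mem_compSide_iff hv, mem_compl_iff]
      tauto
  · rintro a ⟨ha, ha'⟩ b ⟨hb, hb'⟩ hab
    have haX : a ∉ X := fun h => ha' (subset_compSide h)
    have hbX : b ∉ X := fun h => hb' (subset_compSide h)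
    rw [mem_compSide_iff haX] at ha'
    rw [mem_compSide_iff hbX, ← compOf_eq_of_adj haX hbX hab] at hb
    exact ha' hb
  · rwa [compSide_inter, compl_inter_self, compSide_empty]

lemma sepLE_compSep_swap (h : sᶜ ⊆ t) :
    sepLE (compSep G X s) ((compSep G X t).2, (compSep G X t).1) :=
  ⟨compSide_mono h, compSide_mono (compl_subset_comm.1 h)⟩

end ComponentSeparations

section Tangles

variable {G : SimpleGraph V} {τ : Set (Set V × Set V)} {X : Set V} {s t u : Set ↥(Comps G X)}

lemma IsTangle.compl_mem_tangleUF_iff (hτ : IsTangle G τ) (hX : X.Finite) :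
    sᶜ ∈ tangleUF G τ X ↔ s ∉ tangleUF G τ X := by
  have h := hτ.1.2 _ _ (isFinSep_compSide hX sᶜ)
  rw [compl_compl] at h
  simpa only [mem_tangleUF_iff, compSep, compl_compl] using h

/-- Three sets with pairwise disjoint complements in `U(τ,X)` have a common element. -/
lemma IsTangle.inter_inter_nonempty (hτ : IsTangle G τ) (hX : X.Finite)
    (hs : s ∈ tangleUF G τ X) (ht : t ∈ tangleUF G τ X) (hu : u ∈ tangleUF G τ X)
    (hst : sᶜ ⊆ t) (hsu : sᶜ ⊆ u) (htu : tᶜ ⊆ u) : (s ∩ t ∩ u).Nonempty := by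
  rw [nonempty_iff_ne_empty]
  intro hempty
  have hσ : ({compSep G X s, compSep G X t, compSep G X u} : Set _) ⊆ τ := by
    rintro _ (rfl | rfl | rfl) <;> assumption
  refine hτ.2.2 _ hσ ⟨⟨hσ.trans hτ.1.1, ?_⟩, by simp, ?_, ?_⟩
  · rintro _ (rfl | rfl | rfl) _ (rfl | rfl | rfl) hne <;>
      first
      | exact absurd rfl hne
      | exact sepLE_compSep_swap (by assumption)
      | exact sepLE_compSep_swap (compl_subset_comm.1 (by assumption))
  · exact (ncard_insert_le _ _).trans (Nat.succ_le_succ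
      ((ncard_insert_le _ _).trans (by rw [ncard_singleton])))
  · refine hX.subset ?_
    simp only [mem_insert_iff, mem_singleton_iff, iInter_iInter_eq_or_left, iInter_iInter_eq_left,
      compSep]
    rw [← inter_assoc, compSide_inter, compSide_inter, hempty, compSide_empty]

lemma IsTangle.infinite_compSide (hτ : IsTangle G τ) (hs : s ∈ tangleUF G τ X) :
    (compSide G X s).Infinite := by
  intro hfin
  have hσ : ({compSep G X s} : Set _) ⊆ τ := singleton_subset_iff.2 hs
  refine hτ.2.2 _ hσ ⟨⟨hσ.trans hτ.1.1, ?_⟩, by simp, by simp, ?_⟩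
  · rintro _ rfl _ rfl hne
    exact absurd rfl hne
  · simpa [compSep] using hfin

lemma IsTangle.empty_notMem_tangleUF (hτ : IsTangle G τ) (hX : X.Finite) :
    ∅ ∉ tangleUF G τ X := fun h =>
  hτ.infinite_compSide h (compSide_empty (G := G) ▸ hX)

lemma IsTangle.tangleUF_mono (hτ : IsTangle G τ) (hX : X.Finite)
    (hs : s ∈ tangleUF G τ X) (hst : s ⊆ t) : t ∈ tangleUF G τ X := by
  by_contra ht
  have htc := (hτ.compl_mem_tangleUF_iff hX).2 ht
  rw [mem_tangleUF_iff, compSep, compl_compl] at htc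
  have hs' := hs
  rw [mem_tangleUF_iff, compSep] at hs'
  refine hτ.2.1 _ _ _ _ htc hs' (fun heq => ?_)
    ⟨⟨compSide_mono (compl_subset_compl.2 hst), compSide_mono hst⟩, fun heq => ?_⟩
  · refine hτ.infinite_compSide hs (hX.subset ?_)
    have hside : compSide G X s ⊆ compSide G X tᶜ ∩ compSide G X t :=
      subset_inter (Prod.ext_iff.1 heq).2.ge (compSide_mono hst)
    rwa [compSide_inter, compl_inter_self, compSide_empty] at hside
  · rw [← heq] at hs'
    exact ht hs'

end Tangles

/-- for every `ℵ₀`-tangle `τ` and finite `X ⊆ V`, the collection `U(τ,X)` is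
an ultrafilter on the set `𝒞_X` of components of `G − X`. -/
theorem stmt7 [Infinite V] (G : SimpleGraph V) (τ : Set (Set V × Set V))
    (hτ : IsTangle G τ) (X : Set V) (hX : X.Finite) :
    IsUltra (tangleUF G τ X) := by
  refine ⟨hτ.empty_notMem_tangleUF hX, fun s hs t ht => ?_,
    fun s hs t hst => hτ.tangleUF_mono hX hs hst, fun s => ?_⟩
  · by_contra hst
    have hdiff := hτ.tangleUF_mono hX ht (t := (s \ t)ᶜ) fun C hC h => h.2 hC
    obtain ⟨C, hC⟩ := hτ.inter_inter_nonempty hX hs hdiff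
      ((hτ.compl_mem_tangleUF_iff hX).2 hst)
      (fun C hC h => hC h.1) (fun C hC h => hC h.1)
      (fun C hC h => (not_not.1 hC).2 h.2)
    simp only [mem_inter_iff, mem_compl_iff, mem_sdiff] at hC
    tauto
  · rw [hτ.compl_mem_tangleUF_iff hX]
    exact em _
end

section
/- Let X ⊆ X' be finite sets of vertices of G and let U be a non-principal ultrafilter on 𝒞_X. Then there is a unique ultrafilter U' on 𝒞_{X'} with f_{X',X}(U') = U; moreover U' is non-principal and U' = {𝒞 ⊆ 𝒞_{X'} : 𝒞 ∩ 𝒞_X ∈ U}. -/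
open Set

variable {V : Type*}

theorem mem_Comps_iff {G : SimpleGraph V} {X C : Set V} :
    C ∈ Comps G X ↔ ∃ v : ↥Xᶜ,
      C = {w | ∃ hw : w ∈ Xᶜ, (G.induce Xᶜ).Reachable v ⟨w, hw⟩} := by
  constructor
  · rintro ⟨c, rfl⟩
    induction c using SimpleGraph.ConnectedComponent.ind with
    | h v =>
      refine ⟨v, Set.ext fun w => ?_⟩
      simp [SimpleGraph.reachable_comm]
  · rintro ⟨v, rfl⟩
    refine ⟨(G.induce Xᶜ).connectedComponentMk v, Set.ext fun w => ?_⟩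
    simp [SimpleGraph.reachable_comm]

theorem Comps.nonempty {G : SimpleGraph V} {X C : Set V} (hC : C ∈ Comps G X) :
    C.Nonempty := by
  obtain ⟨v, rfl⟩ := mem_Comps_iff.1 hC
  exact ⟨v, v.2, .refl _⟩

theorem Comps.eq_of_mem {G : SimpleGraph V} {X C D : Set V} (hC : C ∈ Comps G X)
    (hD : D ∈ Comps G X) {v : V} (hvC : v ∈ C) (hvD : v ∈ D) : C = D := by
  obtain ⟨a, rfl⟩ := mem_Comps_iff.1 hC
  obtain ⟨b, rfl⟩ := mem_Comps_iff.1 hD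
  obtain ⟨_, ha⟩ := hvC
  obtain ⟨_, hb⟩ := hvD
  ext w
  exact ⟨fun ⟨hw, h⟩ => ⟨hw, hb.trans (ha.symm.trans h)⟩,
    fun ⟨hw, h⟩ => ⟨hw, ha.trans (hb.symm.trans h)⟩⟩

theorem Comps.eq_of_subset {G : SimpleGraph V} {X C D : Set V} (hC : C ∈ Comps G X)
    (hD : D ∈ Comps G X) (h : C ⊆ D) : C = D := by
  obtain ⟨v, hv⟩ := Comps.nonempty hC
  exact Comps.eq_of_mem hC hD hv (h hv)

theorem Comps.exists_superset {G : SimpleGraph V} {X X' C' : Set V} (hXX' : X ⊆ X')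
    (hC' : C' ∈ Comps G X') : ∃ C ∈ Comps G X, C' ⊆ C := by
  obtain ⟨v, rfl⟩ := mem_Comps_iff.1 hC'
  have hsub : X'ᶜ ⊆ Xᶜ := Set.compl_subset_compl.2 hXX'
  refine ⟨_, mem_Comps_iff.2 ⟨⟨v, hsub v.2⟩, rfl⟩, ?_⟩
  rintro w ⟨hw, h⟩
  exact ⟨hsub hw, h.map (SimpleGraph.induceHomOfLE G hsub).toHom⟩

/-- A walk of `G − X` avoids `X'` as soon as everything reachable from its start does. -/
theorem reachable_induce_of_walk {G : SimpleGraph V} {X X' : Set V} {a b : ↥Xᶜ}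
    (p : (G.induce Xᶜ).Walk a b)
    (h : ∀ u, (G.induce Xᶜ).Reachable a u → (u : V) ∈ X'ᶜ) :
    ∃ (ha : (a : V) ∈ X'ᶜ) (hb : (b : V) ∈ X'ᶜ),
      (G.induce X'ᶜ).Reachable ⟨a, ha⟩ ⟨b, hb⟩ := by
  induction p with
  | nil => exact ⟨h _ (.refl _), h _ (.refl _), .refl _⟩
  | cons hadj p ih =>
    obtain ⟨hu, hb, hr⟩ := ih fun u hu => h u (hadj.reachable.trans hu)
    refine ⟨h _ (.refl _), hb, SimpleGraph.Reachable.trans (SimpleGraph.Adj.reachable ?_) hr⟩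
    exact hadj

theorem Comps.mem_of_disjoint {G : SimpleGraph V} {X X' C : Set V} (hXX' : X ⊆ X')
    (hC : C ∈ Comps G X) (hd : Disjoint C X') : C ∈ Comps G X' := by
  obtain ⟨v, hv⟩ := mem_Comps_iff.1 hC
  have havoid : ∀ u, (G.induce Xᶜ).Reachable v u → (u : V) ∈ X'ᶜ := fun u hu =>
    Set.disjoint_left.1 hd (hv ▸ ⟨u.2, hu⟩)
  have hvX' : (v : V) ∈ X'ᶜ := havoid v (.refl _)
  have hD := (mem_Comps_iff (G := G)).2 ⟨(⟨v, hvX'⟩ : ↥X'ᶜ), rfl⟩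
  obtain ⟨E, hE, hDE⟩ := Comps.exists_superset hXX' hD
  have hEC : E = C := Comps.eq_of_mem hE hC (hDE ⟨hvX', .refl _⟩) (hv ▸ ⟨v.2, .refl _⟩)
  convert hD using 1
  refine Set.Subset.antisymm ?_ (hEC ▸ hDE)
  intro w hw
  rw [hv] at hw
  obtain ⟨_, ⟨p⟩⟩ := hw
  obtain ⟨_, hb, hr⟩ := reachable_induce_of_walk p havoid
  exact ⟨hb, hr⟩

/-- Only finitely many components of `G − X` meet a given finite set. -/
theorem Comps.finite_not_disjoint (G : SimpleGraph V) (X : Set V) {X' : Set V}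
    (hX' : X'.Finite) : {C : ↥(Comps G X) | ¬ Disjoint (C : Set V) X'}.Finite := by
  have h : ∀ C : ↥(Comps G X), ¬ Disjoint (C : Set V) X' → ∃ v ∈ X', v ∈ (C : Set V) :=
    fun C hC => by
      obtain ⟨v, hvC, hvX'⟩ := Set.not_disjoint_iff.1 hC
      exact ⟨v, hvX', hvC⟩
  have hsub : ∀ v, {C : ↥(Comps G X) | v ∈ (C : Set V)}.Subsingleton :=
    fun v C hC D hD => Subtype.ext (Comps.eq_of_mem C.2 D.2 hC hD)
  refine (hX'.biUnion fun v _ => (hsub v).finite).subset fun C hC => ?_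
  obtain ⟨v, hv, hvC⟩ := h C hC
  exact Set.mem_biUnion hv hvC

theorem IsUltra.compl_mem_of_finite {α : Type*} {F : Set (Set α)} (hF : IsUltra F)
    (hnp : ¬ IsPrincipalUF F) {s : Set α} (hs : s.Finite) : sᶜ ∈ F := by
  obtain ⟨hempty, hinter, hmono, hcompl⟩ := hF
  induction s, hs using Set.Finite.induction_on with
  | empty => exact (hcompl ∅).resolve_left hempty
  | @insert a s _ _ ih =>
    rw [Set.insert_eq, Set.compl_union]
    refine hinter _ ((hcompl {a}).resolve_left fun ha => hnp ⟨a, ?_⟩) _ ih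
    ext t
    refine ⟨fun ht => ?_, fun hat => hmono _ ha t (Set.singleton_subset_iff.2 hat)⟩
    by_contra hat
    refine hempty (hmono _ (hinter _ ht _ ha) ∅ ?_)
    rintro x ⟨hxt, rfl⟩
    exact hat hxt

/-- The sets of components of `G − X'` whose trace on `𝒞_X` belongs to `U`. -/
def traceUF (G : SimpleGraph V) (X X' : Set V) (U : Set (Set ↥(Comps G X))) :
    Set (Set ↥(Comps G X')) :=
  {𝒞 | {C : ↥(Comps G X) | ∃ D ∈ 𝒞, (D : Set V) = (C : Set V)} ∈ U}

theorem isUltra_traceUF {G : SimpleGraph V} {X X' : Set V} (hXX' : X ⊆ X')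
    {U : Set (Set ↥(Comps G X))} (hU : IsUltra U)
    (hN : {C : ↥(Comps G X) | Disjoint (C : Set V) X'} ∈ U) :
    IsUltra (traceUF G X X' U) := by
  obtain ⟨hempty, hinter, hmono, hcompl⟩ := hU
  refine ⟨fun h => hempty (hmono _ h _ ?_), fun s hs t ht => hmono _ (hinter _ hs _ ht) _ ?_,
    fun s hs t hst => hmono _ hs _ ?_, fun s => or_iff_not_imp_left.2 fun hs => ?_⟩
  · rintro C ⟨D, hD, _⟩
    exact hD
  · rintro C ⟨⟨D, hD, hDC⟩, E, hE, hEC⟩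
    exact ⟨D, ⟨hD, Subtype.ext (hDC.trans hEC.symm) ▸ hE⟩, hDC⟩
  · rintro C ⟨D, hD, hDC⟩
    exact ⟨D, hst hD, hDC⟩
  · refine hmono _ (hinter _ ((hcompl _).resolve_left hs) _ hN) _ ?_
    rintro C ⟨hCs, hCd⟩
    exact ⟨⟨C, Comps.mem_of_disjoint hXX' C.2 hCd⟩, fun h => hCs ⟨_, h, rfl⟩, rfl⟩

theorem pushUF_traceUF {G : SimpleGraph V} {X X' : Set V} (hXX' : X ⊆ X')
    {U : Set (Set ↥(Comps G X))} (hU : IsUltra U)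
    (hN : {C : ↥(Comps G X) | Disjoint (C : Set V) X'} ∈ U) :
    pushUF G X X' (traceUF G X X' U) = U := by
  obtain ⟨_, hinter, hmono, _⟩ := hU
  ext 𝒮
  refine ⟨fun h => hmono _ h _ ?_, fun h => hmono _ (hinter _ h _ hN) _ ?_⟩
  · rintro C ⟨D, ⟨E, hE, hDE⟩, hDC⟩
    exact Subtype.ext (Comps.eq_of_subset C.2 E.2 (hDC ▸ hDE)) ▸ hE
  · rintro C ⟨hC, hCd⟩
    exact ⟨⟨C, Comps.mem_of_disjoint hXX' C.2 hCd⟩, ⟨C, hC, subset_rfl⟩, rfl⟩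

theorem eq_traceUF_pushUF {G : SimpleGraph V} {X X' : Set V} (hXX' : X ⊆ X')
    {U' : Set (Set ↥(Comps G X'))} (hU' : IsUltra U')
    (hN : {C : ↥(Comps G X) | Disjoint (C : Set V) X'} ∈ pushUF G X X' U') :
    U' = traceUF G X X' (pushUF G X X' U') := by
  obtain ⟨_, hinter, hmono, _⟩ := hU'
  ext 𝒞
  refine ⟨fun h => hmono _ (hinter _ h _ hN) _ ?_, fun h => hmono _ h _ ?_⟩
  · rintro D ⟨hD, C, hCd, hDC⟩
    exact ⟨C, ⟨D, hD, Comps.eq_of_subset D.2 (Comps.mem_of_disjoint hXX' C.2 hCd) hDC⟩, hDC⟩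
  · rintro D ⟨C, ⟨E, hE, hEC⟩, hDC⟩
    exact Subtype.ext (Comps.eq_of_subset D.2 E.2 (hEC ▸ hDC)) ▸ hE

theorem IsPrincipalUF.pushUF {G : SimpleGraph V} {X X' : Set V} (hXX' : X ⊆ X')
    {U' : Set (Set ↥(Comps G X'))} (hU' : IsPrincipalUF U') :
    IsPrincipalUF (pushUF G X X' U') := by
  obtain ⟨a, rfl⟩ := hU'
  obtain ⟨C, hC, haC⟩ := Comps.exists_superset hXX' a.2
  refine ⟨⟨C, hC⟩, Set.ext fun 𝒮 => ⟨?_, fun h => ⟨_, h, haC⟩⟩⟩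
  rintro ⟨D, hD, haD⟩
  obtain ⟨v, hv⟩ := Comps.nonempty a.2
  have hDC : D = ⟨C, hC⟩ := Subtype.ext (Comps.eq_of_mem D.2 hC (haD hv) (haC hv))
  exact hDC ▸ hD

/-- Lemma 3.1: for finite `X ⊆ X'` and a non-principal ultrafilter `U` on
`𝒞_X` there is a unique ultrafilter `U'` on `𝒞_{X'}` with `f_{X',X}(U') = U`; moreover
`U'` is non-principal and `U' = {𝒞 ⊆ 𝒞_{X'} : 𝒞 ∩ 𝒞_X ∈ U}`. -/
theorem stmt11 [Infinite V] (G : SimpleGraph V) (X X' : Set V)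
    (hX : X.Finite) (hX' : X'.Finite) (hXX' : X ⊆ X')
    (U : Set (Set ↥(Comps G X))) (hU : IsUltra U) (hnp : ¬ IsPrincipalUF U) :
    (∃! U' : Set (Set ↥(Comps G X')), IsUltra U' ∧ pushUF G X X' U' = U) ∧
    ∀ U' : Set (Set ↥(Comps G X')), IsUltra U' → pushUF G X X' U' = U →
      ¬ IsPrincipalUF U' ∧
      U' = {𝒞 : Set ↥(Comps G X') |
        {C : ↥(Comps G X) | ∃ D ∈ 𝒞, (D : Set V) = (C : Set V)} ∈ U} := by
  have hN : {C : ↥(Comps G X) | Disjoint (C : Set V) X'} ∈ U := by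
    have h := hU.compl_mem_of_finite hnp (Comps.finite_not_disjoint G X hX')
    simpa only [Set.compl_ofPred, not_not] using h
  have huniq : ∀ U' : Set (Set ↥(Comps G X')), IsUltra U' → pushUF G X X' U' = U →
      U' = traceUF G X X' U := by
    rintro U' hU' rfl
    exact eq_traceUF_pushUF hXX' hU' hN
  refine ⟨⟨_, ⟨isUltra_traceUF hXX' hU hN, pushUF_traceUF hXX' hU hN⟩,
    fun U' h => huniq U' h.1 h.2⟩, fun U' hU' hpush => ⟨fun hp => hnp ?_, huniq U' hU' hpush⟩⟩
  exact hpush ▸ hp.pushUF hXX'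
end
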